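/- arXiv:1407.8465 — 2 statements merged into one kernel-verified Lean document; each statement's English description precedes it below -/
import Mathlib

section
/- Let p > 3 be a prime. Then Σ_{k=0}^{p-1} binom(2k,k)·binom(3k,k)/27^k · H_k^{(2)} ≡ (1/2)·Σ_{k=0}^{p-1} binom(2k,k)·binom(3k,k)/((2k+1)·27^k) · H_k^{(2)} ≡ (1/5)·Σ_{k=0}^{p-1} binom(6k,3k)·binom(3k,k)/((2k+1)·432^k) · H_k^{(2)} ≡ (3p-3)·B_{p²-p-1}(1/3) (mod p²), and these quantities are ≡ -(3/2)·B_{p-2}(1/3) (mod p). -/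
open Finset

/-- Generalized binomial coefficient `C(a,k) = a(a-1)⋯(a-k+1)/k!` for a rational `a`. -/
noncomputable def gchoose (a : ℚ) (k : ℕ) : ℚ :=
  (∏ j ∈ Finset.range k, (a - j)) / (Nat.factorial k : ℚ)

/-- The harmonic number `H_k = ∑_{j=1}^k 1/j`. -/
def harm (k : ℕ) : ℚ := ∑ j ∈ Finset.range k, (1 : ℚ) / (j + 1)

/-- The second-order harmonic number `H_k^{(2)} = ∑_{j=1}^k 1/j²`. -/
def harm2 (k : ℕ) : ℚ := ∑ j ∈ Finset.range k, (1 : ℚ) / (j + 1) ^ 2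

/-- `x ≡ y (mod p^m)` for rationals: the p-adic valuation of `x - y` is at least `m`
(with the convention that the valuation of `0` is `+∞`). -/
def CongrMod (p m : ℕ) (x y : ℚ) : Prop :=
  x = y ∨ (m : ℤ) ≤ padicValRat p (x - y)

/-- The Bernoulli polynomial `B_n` evaluated at a rational `x`. -/
noncomputable def bpoly (n : ℕ) (x : ℚ) : ℚ := (Polynomial.bernoulli n).eval x

/-- The Euler polynomial `E_n` evaluated at a rational `x`, via
`E_n(x) = (2/(n+1))·(B_{n+1}(x) − 2^{n+1}·B_{n+1}(x/2))`. -/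
noncomputable def epoly (n : ℕ) (x : ℚ) : ℚ :=
  (2 / (n + 1 : ℚ)) * (bpoly (n + 1) x - 2 ^ (n + 1) * bpoly (n + 1) (x / 2))

/-- The Euler number `E_n = 2^n · E_n(1/2)`. -/
noncomputable def eulerNum (n : ℕ) : ℚ := 2 ^ n * epoly n (1 / 2)

/-- The rationals of `p`-adic valuation at least `e`, as an additive group. -/
def padicBall (p : ℕ) [Fact p.Prime] (e : ℕ) : AddSubgroup ℚ where
  carrier := {x | padicNorm p x ≤ (p : ℚ) ^ (-(e : ℤ))}
  zero_mem' := by simp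
  add_mem' hx hy := padicNorm.nonarchimedean.trans (max_le hx hy)
  neg_mem' hx := by simpa using hx

section padic

variable {p : ℕ} [hp : Fact p.Prime]

lemma mem_padicBall {e : ℕ} {x : ℚ} :
    x ∈ padicBall p e ↔ padicNorm p x ≤ (p : ℚ) ^ (-(e : ℤ)) := Iff.rfl

lemma mem_padicBall_zero {x : ℚ} : x ∈ padicBall p 0 ↔ padicNorm p x ≤ 1 := by
  simp [mem_padicBall]

lemma congrMod_iff {e : ℕ} {x y : ℚ} : CongrMod p e x y ↔ x - y ∈ padicBall p e := by
  unfold CongrMod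
  by_cases h : x = y
  · simp [h, zero_mem]
  have hxy : x - y ≠ 0 := sub_ne_zero.2 h
  have h1 : (1 : ℚ) < p := by exact_mod_cast hp.out.one_lt
  rw [mem_padicBall, padicNorm.eq_zpow_of_nonzero hxy, zpow_le_zpow_iff_right₀ h1]
  simp [h]

lemma padicBall_mono {e f : ℕ} (h : f ≤ e) {x : ℚ} (hx : x ∈ padicBall p e) :
    x ∈ padicBall p f := by
  have h1 : (1 : ℚ) ≤ p := by exact_mod_cast hp.out.one_lt.le
  refine le_trans hx (zpow_le_zpow_right₀ h1 (by omega))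

lemma mul_mem_padicBall {e f : ℕ} {x y : ℚ} (hx : x ∈ padicBall p e) (hy : y ∈ padicBall p f) :
    x * y ∈ padicBall p (e + f) := by
  have h0 : (p : ℚ) ≠ 0 := by exact_mod_cast hp.out.ne_zero
  rw [mem_padicBall] at *
  rw [padicNorm.mul, Nat.cast_add, neg_add, zpow_add₀ h0]
  exact mul_le_mul hx hy (padicNorm.nonneg _) (by positivity)

lemma integral_mul_mem {e : ℕ} {x y : ℚ} (hx : x ∈ padicBall p 0) (hy : y ∈ padicBall p e) :
    x * y ∈ padicBall p e := by
  simpa using mul_mem_padicBall hx hy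

lemma natCast_mem_padicBall (n : ℕ) : (n : ℚ) ∈ padicBall p 0 :=
  mem_padicBall_zero.2 (padicNorm.of_nat n)

lemma intCast_mem_padicBall (n : ℤ) : (n : ℚ) ∈ padicBall p 0 :=
  mem_padicBall_zero.2 (padicNorm.of_int n)

lemma one_mem_padicBall : (1 : ℚ) ∈ padicBall p 0 := mod_cast natCast_mem_padicBall 1

lemma prime_mem_padicBall : (p : ℚ) ∈ padicBall p 1 := by
  simp [mem_padicBall]

lemma prod_mem_padicBall {ι : Type*} {s : Finset ι} {f : ι → ℚ}
    (h : ∀ i ∈ s, f i ∈ padicBall p 0) : ∏ i ∈ s, f i ∈ padicBall p 0 := by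
  classical
  induction s using Finset.induction_on with
  | empty => simpa using one_mem_padicBall
  | insert a s ha ih =>
    rw [Finset.prod_insert ha]
    exact integral_mul_mem (h _ (by simp)) (ih fun i hi => h i (by simp [hi]))

lemma prod_mem_padicBall_one {ι : Type*} {s : Finset ι} {f : ι → ℚ}
    (h : ∀ i ∈ s, f i ∈ padicBall p 0) {i : ι} (hi : i ∈ s) (hfi : f i ∈ padicBall p 1) :
    ∏ i ∈ s, f i ∈ padicBall p 1 := by
  classical
  rw [← Finset.prod_erase_mul _ _ hi]
  exact integral_mul_mem (prod_mem_padicBall fun j hj => h j (Finset.mem_of_mem_erase hj)) hfi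

lemma pow_mem_padicBall {x : ℚ} (hx : x ∈ padicBall p 0) (n : ℕ) : x ^ n ∈ padicBall p 0 := by
  simpa using prod_mem_padicBall (s := Finset.range n) (f := fun _ => x) fun _ _ => hx

lemma inv_mem_padicBall {x : ℚ} (hx : padicNorm p x = 1) : x⁻¹ ∈ padicBall p 0 := by
  rw [mem_padicBall_zero, ← one_div, padicNorm.div, hx]; simp

lemma padicNorm_natCast_eq_one {n : ℕ} (h0 : 0 < n) (h : n < p) : padicNorm p n = 1 :=
  (padicNorm.nat_eq_one_iff n).2 (Nat.not_dvd_of_pos_of_lt h0 h)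

lemma padicNorm_add_eq_one {x y : ℚ} (hx : padicNorm p x = 1) (hy : y ∈ padicBall p 1) :
    padicNorm p (x + y) = 1 := by
  have h1 : (1 : ℚ) < p := by exact_mod_cast hp.out.one_lt
  have hlt : padicNorm p y < 1 := lt_of_le_of_lt hy (by simpa using inv_lt_one_of_one_lt₀ h1)
  rw [padicNorm.add_eq_max_of_ne (by rw [hx]; exact hlt.ne'), hx, max_eq_left hlt.le]

/-- Cancellation of a unit factor. -/
lemma mem_of_unit_mul_mem {e : ℕ} {x c : ℚ} (hc : padicNorm p c = 1)
    (h : c * x ∈ padicBall p e) : x ∈ padicBall p e := by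
  rwa [mem_padicBall, padicNorm.mul, hc, one_mul] at h

/-- Euler's theorem for rational `p`-adic units. -/
lemma pow_totient_sub_one_mem {x : ℚ} (hx : padicNorm p x = 1) (e : ℕ) :
    x ^ Nat.totient (p ^ e) - 1 ∈ padicBall p e := by
  have hcop : ∀ n : ℤ, ¬ (p : ℤ) ∣ n →
      (n : ℚ) ^ Nat.totient (p ^ e) - 1 ∈ padicBall p e := by
    intro n hn
    have h2 : IsCoprime n ((p ^ e : ℕ) : ℤ) := by
      push_cast
      exact (((Nat.prime_iff_prime_int.1 hp.out).coprime_iff_not_dvd.2 hn).symm).pow_right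
    have h3 := ZMod.pow_totient (ZMod.unitOfIsCoprime n h2)
    have h4 : ((p ^ e : ℕ) : ℤ) ∣ n ^ Nat.totient (p ^ e) - 1 := by
      rw [← ZMod.intCast_zmod_eq_zero_iff_dvd]
      have := congrArg Units.val h3
      push_cast at this ⊢
      rw [ZMod.coe_unitOfIsCoprime] at this
      rw [this]; simp
    have := padicNorm.dvd_iff_norm_le.1 h4
    rw [mem_padicBall]
    exact_mod_cast this
  have hden : ¬ (p : ℤ) ∣ (x.den : ℤ) := by
    intro h
    have hn : ¬ (p : ℤ) ∣ x.num := by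
      intro h'
      have h3 := Nat.dvd_gcd (Int.natCast_dvd.1 h') (Int.natCast_dvd_natCast.1 h)
      rw [x.reduced.gcd_eq_one] at h3
      exact hp.out.one_lt.ne' (Nat.dvd_one.1 h3)
    have h1 : padicNorm p (x.num : ℚ) = 1 := (padicNorm.int_eq_one_iff _).2 hn
    have h2 : padicNorm p ((x.den : ℤ) : ℚ) < 1 := (padicNorm.int_lt_one_iff _).2 h
    rw [← x.num_div_den, padicNorm.div, h1] at hx
    have : padicNorm p ((x.den : ℤ) : ℚ) = 1 := by
      push_cast
      simpa using hx
    exact h2.ne this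
  have hd : padicNorm p (x.den : ℚ) = 1 := by
    exact_mod_cast (padicNorm.int_eq_one_iff (p := p) (x.den : ℤ)).2 hden
  have hnum : ¬ (p : ℤ) ∣ x.num := by
    rw [← padicNorm.int_eq_one_iff, ← hx]
    conv_rhs => rw [← x.num_div_den, padicNorm.div, hd, div_one]
  have hn := hcop _ hnum
  have hdd := hcop _ hden
  have hd0 : (x.den : ℚ) ≠ 0 := by exact_mod_cast x.den_ne_zero
  refine mem_of_unit_mul_mem (c := (x.den : ℚ) ^ Nat.totient (p ^ e)) ?_ ?_
  · clear * - hd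
    induction Nat.totient (p ^ e) with
    | zero => simp
    | succ n ih => rw [pow_succ, padicNorm.mul, ih, hd, one_mul]
  · have : (x.den : ℚ) ^ Nat.totient (p ^ e) * (x ^ Nat.totient (p ^ e) - 1) =
      ((x.num : ℚ) ^ Nat.totient (p ^ e) - 1) -
        (((x.den : ℤ) : ℚ) ^ Nat.totient (p ^ e) - 1) := by
      rw [mul_sub, ← mul_pow, mul_comm (x.den : ℚ) x, Rat.mul_den_eq_num]
      push_cast; ring
    rw [this]
    exact sub_mem hn hdd

end padic

/-- The product `binom(a, k) * binom(-1 - a, k)`. -/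
def chooseProd (a : ℚ) (k : ℕ) : ℚ :=
  ∏ j ∈ Finset.range k, ((j - a) * (j + 1 + a) / ((j : ℚ) + 1) ^ 2)

/-- The product of `1 - a ^ 2 / j ^ 2` over `1 ≤ j ≤ n`. -/
def sineProd (a : ℚ) (n : ℕ) : ℚ :=
  ∏ j ∈ Finset.range n, ((j + 1 - a) * (j + 1 + a) / ((j : ℚ) + 1) ^ 2)

lemma chooseProd_neg_one_sub (a : ℚ) (k : ℕ) : chooseProd (-1 - a) k = chooseProd a k := by
  refine Finset.prod_congr rfl fun j _ => ?_
  ring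

lemma chooseProd_zero_succ (k : ℕ) : chooseProd 0 (k + 1) = 0 :=
  Finset.prod_eq_zero (i := 0) (by simp) (by simp)

lemma sineProd_succ (a : ℚ) (n : ℕ) :
    sineProd a (n + 1) = sineProd a n * ((n + 1 - a) * (n + 1 + a) / ((n : ℚ) + 1) ^ 2) :=
  Finset.prod_range_succ _ _

lemma harm2_succ (n : ℕ) : harm2 (n + 1) = harm2 n + 1 / ((n : ℚ) + 1) ^ 2 :=
  Finset.sum_range_succ _ _

lemma chooseProd_succ (a : ℚ) (k : ℕ) :
    chooseProd a (k + 1) = sineProd a k * (-a * (k + 1 + a) / ((k : ℚ) + 1) ^ 2) := by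
  induction k with
  | zero => simp [chooseProd, sineProd]
  | succ k ih =>
    rw [chooseProd, Finset.prod_range_succ, ← chooseProd, ih, sineProd_succ]
    have h1 : (k : ℚ) + 1 ≠ 0 := by positivity
    have h2 : (k : ℚ) + 1 + 1 ≠ 0 := by positivity
    push_cast
    field_simp

lemma chooseProd_sub_one_succ (a : ℚ) (k : ℕ) :
    chooseProd (a - 1) (k + 1) = sineProd a k * (a * (k + 1 - a) / ((k : ℚ) + 1) ^ 2) := by
  rw [← chooseProd_neg_one_sub, show -1 - (a - 1) = -a by ring, chooseProd_succ]
  have : sineProd (-a) k = sineProd a k := Finset.prod_congr rfl fun j _ => by ring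
  rw [this]; ring

lemma sum_chooseProd_add_mul_harm2 {a : ℚ} (ha : a ≠ 0) (n : ℕ) :
    ∑ k ∈ Finset.range (n + 1), (chooseProd a k + chooseProd (a - 1) k) * harm2 k =
      2 * sineProd a n * harm2 n + 2 / a ^ 2 * (sineProd a n - 1) := by
  induction n with
  | zero => simp [sineProd, harm2]
  | succ n ih =>
    rw [Finset.sum_range_succ, ih, chooseProd_succ, chooseProd_sub_one_succ, sineProd_succ,
      harm2_succ]
    have h1 : (n : ℚ) + 1 ≠ 0 := by positivity
    field_simp
    ring

lemma chooseProd_weighted_sub (a : ℚ) (k : ℕ) :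
    (2 * a + 1) * (chooseProd a k / (2 * k + 1)) -
      (2 * a - 1) * (chooseProd (a - 1) k / (2 * k + 1)) =
      chooseProd a k + chooseProd (a - 1) k := by
  cases k with
  | zero => simp [chooseProd]
  | succ k =>
    rw [chooseProd_succ, chooseProd_sub_one_succ]
    have h1 : (k : ℚ) + 1 ≠ 0 := by positivity
    have h2 : (2 : ℚ) * ((k + 1 : ℕ) : ℚ) + 1 ≠ 0 := by positivity
    push_cast at *
    field_simp
    ring

lemma choose_mul_choose_div_pow_27 (k : ℕ) :
    (Nat.choose (2 * k) k : ℚ) * (Nat.choose (3 * k) k) / 27 ^ k = chooseProd (-1 / 3) k := by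
  have h (k : ℕ) : (Nat.choose (2 * k) k : ℚ) * (Nat.choose (3 * k) k) =
      (3 * k).factorial / (k.factorial : ℚ) ^ 3 := by
    rw [Nat.cast_choose ℚ (by omega : k ≤ 2 * k), Nat.cast_choose ℚ (by omega : k ≤ 3 * k),
      show 2 * k - k = k by omega, show 3 * k - k = 2 * k by omega]
    have h1 : (k.factorial : ℚ) ≠ 0 := by positivity
    have h2 : ((2 * k).factorial : ℚ) ≠ 0 := by positivity
    field_simp
  rw [h]
  induction k with
  | zero => simp [chooseProd]
  | succ k ih =>
    rw [chooseProd, Finset.prod_range_succ, ← chooseProd, ← ih,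
      show 3 * (k + 1) = 3 * k + 1 + 1 + 1 by ring]
    simp only [Nat.factorial_succ]
    push_cast
    have h1 : (k.factorial : ℚ) ≠ 0 := by positivity
    have h2 : (k : ℚ) + 1 ≠ 0 := by positivity
    field_simp
    ring

lemma choose_mul_choose_div_pow_432 (k : ℕ) :
    (Nat.choose (6 * k) (3 * k) : ℚ) * (Nat.choose (3 * k) k) / 432 ^ k =
      chooseProd (-1 / 6) k := by
  have h (k : ℕ) : (Nat.choose (6 * k) (3 * k) : ℚ) * (Nat.choose (3 * k) k) =
      (6 * k).factorial / ((3 * k).factorial * k.factorial * (2 * k).factorial : ℚ) := by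
    rw [Nat.cast_choose ℚ (by omega : 3 * k ≤ 6 * k), Nat.cast_choose ℚ (by omega : k ≤ 3 * k),
      show 6 * k - 3 * k = 3 * k by omega, show 3 * k - k = 2 * k by omega]
    have h1 : (k.factorial : ℚ) ≠ 0 := by positivity
    have h2 : ((2 * k).factorial : ℚ) ≠ 0 := by positivity
    have h3 : ((3 * k).factorial : ℚ) ≠ 0 := by positivity
    field_simp
  rw [h]
  induction k with
  | zero => simp [chooseProd]
  | succ k ih =>
    rw [chooseProd, Finset.prod_range_succ, ← chooseProd, ← ih,
      show 3 * (k + 1) = 3 * k + 1 + 1 + 1 by ring, show 2 * (k + 1) = 2 * k + 1 + 1 by ring,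
      show 6 * (k + 1) = 6 * k + 1 + 1 + 1 + 1 + 1 + 1 by ring]
    simp only [Nat.factorial_succ]
    push_cast
    have h1 : (k.factorial : ℚ) ≠ 0 := by positivity
    have h2 : ((2 * k).factorial : ℚ) ≠ 0 := by positivity
    have h3 : ((3 * k).factorial : ℚ) ≠ 0 := by positivity
    have h4 : (k : ℚ) + 1 ≠ 0 := by positivity
    field_simp
    ring

/-- The sum of `1 / (i + x) ^ 2` over `1 ≤ i ≤ r`. -/
def shiftSum (x : ℚ) (r : ℕ) : ℚ := ∑ i ∈ Finset.range r, 1 / ((i : ℚ) + 1 + x) ^ 2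

/-- The sum of `(-1) ^ i / (i + x) ^ 2` over `1 ≤ i ≤ r`. -/
def altShiftSum (x : ℚ) (r : ℕ) : ℚ :=
  ∑ i ∈ Finset.range r, (-1) ^ (i + 1) / ((i : ℚ) + 1 + x) ^ 2

lemma shiftSum_zero (r : ℕ) : shiftSum 0 r = harm2 r := by
  simp [shiftSum, harm2]

lemma altShiftSum_eq (x : ℚ) (r : ℕ) :
    altShiftSum x r = shiftSum (x / 2) (r / 2) / 2 - shiftSum x r := by
  have hs (y : ℚ) (n : ℕ) : shiftSum y (n + 1) = shiftSum y n + 1 / ((n : ℚ) + 1 + y) ^ 2 :=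
    Finset.sum_range_succ _ _
  induction r with
  | zero => simp [altShiftSum, shiftSum]
  | succ r ih =>
    rw [altShiftSum, Finset.sum_range_succ, ← altShiftSum, ih, hs x r]
    rcases Nat.even_or_odd' r with ⟨u, rfl | rfl⟩
    · rw [show (2 * u + 1) / 2 = u by omega, show 2 * u / 2 = u by omega,
        Odd.neg_one_pow ⟨u, rfl⟩]
      ring
    · rw [show (2 * u + 1 + 1) / 2 = u + 1 by omega, show (2 * u + 1) / 2 = u by omega,
        hs (x / 2) u,
        Even.neg_one_pow ⟨u + 1, by ring⟩]
      push_cast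
      rw [show (2 * u + 1 + 1 + x : ℚ) = 2 * (u + 1 + x / 2) by ring, mul_pow]
      field_simp
      ring

lemma sum_range_two_mul_reflect (F : ℕ → ℚ) (q : ℕ) :
    ∑ k ∈ Finset.range (2 * q), F k = ∑ j ∈ Finset.range q, (F j + F (2 * q - 1 - j)) := by
  rw [two_mul, Finset.sum_range_add, Finset.sum_add_distrib,
    ← Finset.sum_range_reflect (fun j => F (q + j))]
  congr 1
  refine Finset.sum_congr rfl fun j hj => ?_
  rw [Finset.mem_range] at hj
  congr 1
  omega

lemma sum_range_two_mul_parity (F : ℕ → ℚ) (q : ℕ) :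
    ∑ k ∈ Finset.range (2 * q), F k =
      ∑ j ∈ Finset.range q, (F (2 * j + 1) + F (2 * (q - 1 - j))) := by
  rw [Finset.sum_add_distrib, Finset.sum_range_reflect (fun j => F (2 * j)),
    ← Finset.sum_add_distrib]
  induction q with
  | zero => simp
  | succ q ih =>
    rw [show 2 * (q + 1) = 2 * q + 1 + 1 by ring, Finset.sum_range_succ, Finset.sum_range_succ,
      ih, Finset.sum_range_succ]
    ring

section congruences

lemma padicNorm_ne_zero_of_eq_one {p : ℕ} {x : ℚ} (hx : padicNorm p x = 1) : x ≠ 0 := by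
  rintro rfl; simp at hx

variable {p : ℕ} [hp : Fact p.Prime]

lemma padicNorm_mul_eq_one {x y : ℚ} (hx : padicNorm p x = 1) (hy : padicNorm p y = 1) :
    padicNorm p (x * y) = 1 := by
  rw [padicNorm.mul, hx, hy, one_mul]

lemma padicNorm_pow_eq_one {x : ℚ} (hx : padicNorm p x = 1) (n : ℕ) :
    padicNorm p (x ^ n) = 1 := by
  induction n with
  | zero => simp
  | succ n ih => rw [pow_succ, padicNorm.mul, ih, hx, one_mul]

lemma mem_padicBall_of_norm_eq_one {x : ℚ} (hx : padicNorm p x = 1) : x ∈ padicBall p 0 :=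
  mem_padicBall_zero.2 hx.le

lemma padicNorm_succ_eq_one {j : ℕ} (h : j + 1 < p) : padicNorm p ((j : ℚ) + 1) = 1 := by
  exact_mod_cast padicNorm_natCast_eq_one (p := p) (Nat.succ_pos j) h

lemma div_mem_padicBall {e : ℕ} {x y : ℚ} (hx : x ∈ padicBall p e) (hy : padicNorm p y = 1) :
    x / y ∈ padicBall p e := by
  rw [div_eq_inv_mul]
  exact integral_mul_mem (inv_mem_padicBall hy) hx

lemma ofNat_mul_mem {e : ℕ} {x : ℚ} (n : ℕ) [n.AtLeastTwo] (hx : x ∈ padicBall p e) :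
    (OfNat.ofNat n : ℚ) * x ∈ padicBall p e := by
  rw [← Nat.cast_ofNat]
  exact integral_mul_mem (natCast_mem_padicBall n) hx

lemma shiftSum_mem {x : ℚ} (hx : x ∈ padicBall p 1) {r : ℕ} (hr : r < p) :
    shiftSum x r ∈ padicBall p 0 := by
  refine sum_mem fun i hi => ?_
  rw [Finset.mem_range] at hi
  exact div_mem_padicBall one_mem_padicBall
    (padicNorm_pow_eq_one (padicNorm_add_eq_one (padicNorm_succ_eq_one (by omega)) hx) 2)

lemma harm2_mem {k : ℕ} (hk : k < p) : harm2 k ∈ padicBall p 0 := by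
  rw [← shiftSum_zero]
  exact shiftSum_mem (zero_mem _) hk

lemma inv_sq_prime_sub {x : ℚ} (hx : padicNorm p x = 1) :
    1 / (p - x) ^ 2 - 1 / x ^ 2 - 2 * p / x ^ 3 ∈ padicBall p 2 := by
  have h1 : padicNorm p (p - x) = 1 := by
    rw [sub_eq_add_neg, add_comm]
    exact padicNorm_add_eq_one (by rwa [padicNorm.neg]) prime_mem_padicBall
  have hx0 := padicNorm_ne_zero_of_eq_one hx
  have h10 := padicNorm_ne_zero_of_eq_one h1
  have : 1 / (p - x) ^ 2 - 1 / x ^ 2 - 2 * p / x ^ 3 =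
      (p * p) * (3 * x - 2 * p) / (x ^ 3 * (p - x) ^ 2) := by
    field_simp
    ring
  rw [this]
  refine div_mem_padicBall ?_ (padicNorm_mul_eq_one (padicNorm_pow_eq_one hx 3)
    (padicNorm_pow_eq_one h1 2))
  refine mul_mem_padicBall (e := 2) (f := 0)
    (mul_mem_padicBall (e := 1) (f := 1) prime_mem_padicBall prime_mem_padicBall)
    (sub_mem ?_ ?_)
  · exact ofNat_mul_mem 3 (mem_padicBall_of_norm_eq_one hx)
  · exact ofNat_mul_mem 2 (natCast_mem_padicBall p)

lemma padicNorm_two_eq_one (hp3 : 3 < p) : padicNorm p 2 = 1 := by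
  exact_mod_cast padicNorm_natCast_eq_one (p := p) (n := 2) (by omega) (by omega)

lemma padicNorm_three_eq_one (hp3 : 3 < p) : padicNorm p 3 = 1 := by
  exact_mod_cast padicNorm_natCast_eq_one (p := p) (n := 3) (by omega) (by omega)

/-- Relations between the second-order harmonic numbers at `p - 1` and `(p - 1) / 2`. -/
lemma harm2_half (hp3 : 3 < p) :
    7 * harm2 (p - 1) - 2 * harm2 ((p - 1) / 2) ∈ padicBall p 2 ∧
      harm2 (p - 1) ∈ padicBall p 1 ∧ harm2 ((p - 1) / 2) ∈ padicBall p 1 := by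
  obtain ⟨q, hq⟩ : ∃ q, p = 2 * q + 1 := hp.out.odd_of_ne_two (by omega)
  have hq1 : p - 1 = 2 * q := by omega
  have hq2 : (p - 1) / 2 = q := by omega
  have hpq : (p : ℚ) = 2 * q + 1 := by exact_mod_cast hq
  have h2 := padicNorm_two_eq_one hp3
  set G : ℚ := ∑ j ∈ Finset.range q, 1 / ((j : ℚ) + 1) ^ 3
  have hG : G ∈ padicBall p 0 := sum_mem fun j hj => by
    rw [Finset.mem_range] at hj
    exact div_mem_padicBall one_mem_padicBall
      (padicNorm_pow_eq_one (padicNorm_succ_eq_one (by omega)) 3)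
  have hA : harm2 (2 * q) - (2 * harm2 q + 2 * p * G) ∈ padicBall p 2 := by
    have : harm2 (2 * q) - (2 * harm2 q + 2 * p * G) = ∑ j ∈ Finset.range q,
        (1 / (p - ((j : ℚ) + 1)) ^ 2 - 1 / ((j : ℚ) + 1) ^ 2 - 2 * p / ((j : ℚ) + 1) ^ 3) := by
      rw [harm2, harm2, sum_range_two_mul_reflect, Finset.mul_sum, Finset.mul_sum,
        ← Finset.sum_add_distrib, ← Finset.sum_sub_distrib]
      refine Finset.sum_congr rfl fun j hj => ?_
      rw [Finset.mem_range] at hj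
      have : ((2 * q - 1 - j : ℕ) : ℚ) + 1 = p - (j + 1) := by
        rw [show 2 * q - 1 - j = 2 * q - (j + 1) by omega, Nat.cast_sub (by omega), hpq]
        push_cast; ring
      rw [this]
      ring
    rw [this]
    refine sum_mem fun j hj => inv_sq_prime_sub (padicNorm_succ_eq_one ?_)
    rw [Finset.mem_range] at hj; omega
  have hB : 8 * harm2 (2 * q) - (4 * harm2 q + 2 * p * G) ∈ padicBall p 2 := by
    have : 8 * harm2 (2 * q) - (4 * harm2 q + 2 * p * G) = 8 * ∑ j ∈ Finset.range q,
        (1 / (p - 2 * ((j : ℚ) + 1)) ^ 2 - 1 / (2 * ((j : ℚ) + 1)) ^ 2 -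
          2 * p / (2 * ((j : ℚ) + 1)) ^ 3) := by
      rw [harm2, harm2, sum_range_two_mul_parity]
      have hG' : 2 * (p : ℚ) * G = ∑ j ∈ Finset.range q, 2 * p * (1 / ((j : ℚ) + 1) ^ 3) :=
        Finset.mul_sum _ _ _
      rw [hG']
      simp only [Finset.mul_sum]
      rw [← Finset.sum_add_distrib, ← Finset.sum_sub_distrib]
      refine Finset.sum_congr rfl fun j hj => ?_
      rw [Finset.mem_range] at hj
      have : ((2 * (q - 1 - j) : ℕ) : ℚ) + 1 = p - 2 * (j + 1) := by
        rw [show 2 * (q - 1 - j) = 2 * q - 2 * (j + 1) by omega, Nat.cast_sub (by omega), hpq]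
        push_cast; ring
      rw [this]
      have h3 : ((2 * j + 1 : ℕ) : ℚ) + 1 = 2 * (j + 1) := by push_cast; ring
      rw [h3]
      have hj1 : (j : ℚ) + 1 ≠ 0 := by positivity
      simp only [mul_pow]
      generalize 1 / ((p : ℚ) - 2 * (j + 1)) ^ 2 = y
      field_simp
      ring
    rw [this]
    refine ofNat_mul_mem 8 (sum_mem fun j hj =>
      inv_sq_prime_sub (padicNorm_mul_eq_one h2 (padicNorm_succ_eq_one ?_)))
    rw [Finset.mem_range] at hj; omega
  rw [hq2, hq1]
  have hC : 7 * harm2 (2 * q) - 2 * harm2 q ∈ padicBall p 2 := by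
    convert sub_mem hB hA using 1; ring
  have hpG : 2 * p * G ∈ padicBall p 1 :=
    mul_mem_padicBall (e := 1) (f := 0) (ofNat_mul_mem 2 prime_mem_padicBall) hG
  have hh : harm2 (2 * q) ∈ padicBall p 1 := by
    refine mem_of_unit_mul_mem (c := 2 * 3)
      (padicNorm_mul_eq_one h2 (padicNorm_three_eq_one hp3)) ?_
    convert sub_mem (padicBall_mono (f := 1) (by omega) (sub_mem hC hA)) hpG using 1; ring
  refine ⟨hC, hh, mem_of_unit_mul_mem h2 ?_⟩
  convert sub_mem (ofNat_mul_mem 7 hh) (padicBall_mono (f := 1) (by omega) hC) using 1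
  ring

end congruences

section supercongruences

variable {p : ℕ} [hp : Fact p.Prime]

/-- The sum of `binom(a, k) * binom(-1 - a, k) * w k` over `0 ≤ k < n`. -/
def chooseProdSum (w : ℕ → ℚ) (n : ℕ) (a : ℚ) : ℚ :=
  ∑ k ∈ Finset.range n, chooseProd a k * w k

lemma chooseProdSum_neg_one_sub (w : ℕ → ℚ) (n : ℕ) (a : ℚ) :
    chooseProdSum w n (-1 - a) = chooseProdSum w n a := by
  simp only [chooseProdSum, chooseProd_neg_one_sub]

lemma chooseProdSum_zero {w : ℕ → ℚ} (hw : w 0 = 0) (n : ℕ) : chooseProdSum w n 0 = 0 := by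
  refine Finset.sum_eq_zero fun k _ => ?_
  cases k with
  | zero => rw [hw, mul_zero]
  | succ k => rw [chooseProd_zero_succ, zero_mul]

/-- The weight `k ↦ H_k^{(2)} / (2 k + 1)`. -/
def oddHarm2 (k : ℕ) : ℚ := harm2 k / (2 * k + 1)

lemma harm2_zero : harm2 0 = 0 := by simp [harm2]

lemma oddHarm2_zero : oddHarm2 0 = 0 := by simp [oddHarm2, harm2_zero]

lemma padicNorm_shift_eq_one {x : ℚ} (hx : x ∈ padicBall p 1) {i : ℕ} (hi : i + 1 < p) :
    padicNorm p (i + 1 + x) = 1 :=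
  padicNorm_add_eq_one (padicNorm_succ_eq_one hi) hx

lemma oddHarm2_mem (hp3 : 3 < p) {k : ℕ} (hk : k < p) : oddHarm2 k ∈ padicBall p 0 := by
  by_cases h : 2 * k + 1 = p
  · have h1 := (harm2_half hp3).2.2
    rw [show (p - 1) / 2 = k by omega] at h1
    have h2 : (2 * k + 1 : ℚ) = p := by exact_mod_cast h
    have hp0 : (p : ℚ) ≠ 0 := by exact_mod_cast hp.out.ne_zero
    rw [mem_padicBall] at h1
    rw [oddHarm2, h2, mem_padicBall_zero, padicNorm.div, padicNorm.padicNorm_p_of_prime]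
    have : (0 : ℚ) < p := by exact_mod_cast hp.out.pos
    rw [div_le_one (by positivity)]
    simpa using h1
  · refine div_mem_padicBall (harm2_mem hk) ?_
    have : ¬ p ∣ 2 * k + 1 := by
      rintro ⟨c, hc⟩
      have h1 : c ≠ 0 := by rintro rfl; omega
      have h2 : c < 2 := by
        by_contra hc2
        have : p * 2 ≤ p * c := Nat.mul_le_mul_left _ (by omega)
        omega
      have : c = 1 := by omega
      subst this
      omega
    exact_mod_cast (padicNorm.nat_eq_one_iff (p := p) (2 * k + 1)).2 this

lemma add_mem_padicBall_zero {x : ℚ} (hx : x ∈ padicBall p 1) (j : ℕ) :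
    (j : ℚ) + 1 + x ∈ padicBall p 0 :=
  add_mem (add_mem (natCast_mem_padicBall j) one_mem_padicBall)
    (padicBall_mono (by omega) hx)

lemma sineProd_shift_mem {x : ℚ} (hx : x ∈ padicBall p 1) {r : ℕ} (hr : r + 1 < p) :
    sineProd (r + 1 + x) (p - 1) ∈ padicBall p 2 := by
  have ha := add_mem_padicBall_zero hx r
  have h1 (j : ℕ) : (j : ℚ) + 1 ∈ padicBall p 0 :=
    add_mem (natCast_mem_padicBall j) one_mem_padicBall
  rw [sineProd, Finset.prod_div_distrib, Finset.prod_mul_distrib, div_eq_mul_inv,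
    ← Finset.prod_inv_distrib]
  refine mul_mem_padicBall (e := 2) (f := 0) (mul_mem_padicBall (e := 1) (f := 1)
    (prod_mem_padicBall_one (i := r) (fun j _ => sub_mem (h1 j) ha)
      (Finset.mem_range.2 (by omega)) ?_)
    (prod_mem_padicBall_one (i := p - 1 - (r + 1)) (fun j _ => add_mem (h1 j) ha)
      (Finset.mem_range.2 (by omega)) ?_)) (prod_mem_padicBall fun j hj => ?_)
  · convert neg_mem hx using 1; ring
  · rw [show p - 1 - (r + 1) = p - (r + 2) by omega, Nat.cast_sub (by omega)]
    convert add_mem (prime_mem_padicBall (p := p)) hx using 1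
    push_cast; ring
  · rw [Finset.mem_range] at hj
    exact inv_mem_padicBall (padicNorm_pow_eq_one (padicNorm_succ_eq_one (by omega)) 2)

lemma sum_chooseProd_step_mem {x : ℚ} (hx : x ∈ padicBall p 1) {r : ℕ} (hr : r + 1 < p) :
    ∑ k ∈ Finset.range p, (chooseProd (r + 1 + x) k + chooseProd (r + x) k) * harm2 k +
      2 * (1 / ((r : ℚ) + 1 + x) ^ 2) ∈ padicBall p 2 := by
  have hn := padicNorm_shift_eq_one hx hr
  have h := sum_chooseProd_add_mul_harm2 (padicNorm_ne_zero_of_eq_one hn) (p - 1)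
  rw [show p - 1 + 1 = p by omega, show (r : ℚ) + 1 + x - 1 = r + x by ring] at h
  rw [h]
  have hP := sineProd_shift_mem hx hr
  convert add_mem (ofNat_mul_mem 2 (integral_mul_mem (harm2_mem (p := p) (k := p - 1)
    (by omega)) hP)) (ofNat_mul_mem 2 (div_mem_padicBall hP (padicNorm_pow_eq_one hn 2))) using 1
  ring

lemma chooseProdSum_harm2_shift {x : ℚ} (hx : x ∈ padicBall p 1) {r : ℕ} (hr : r < p) :
    chooseProdSum harm2 p (r + x) -
      (-1) ^ r * (chooseProdSum harm2 p x - 2 * altShiftSum x r) ∈ padicBall p 2 := by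
  induction r with
  | zero => simp [altShiftSum, zero_mem]
  | succ r ih =>
    have h := sum_chooseProd_step_mem hx hr
    simp only [add_mul, Finset.sum_add_distrib] at h
    convert sub_mem h (ih (by omega)) using 1
    have h1 : altShiftSum x (r + 1) =
        altShiftSum x r + (-1) ^ (r + 1) / ((r : ℚ) + 1 + x) ^ 2 := Finset.sum_range_succ _ _
    have h2 : ((-1 : ℚ) ^ r) ^ 2 = 1 := by rw [← pow_mul, mul_comm, pow_mul]; simp
    simp only [chooseProdSum, h1, pow_succ]
    push_cast
    linear_combination (2 / ((r : ℚ) + 1 + x) ^ 2) * h2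

lemma chooseProdSum_oddHarm2_shift {x : ℚ} (hx : x ∈ padicBall p 1) {r : ℕ} (hr : r < p) :
    (2 * (r + x) + 1) * chooseProdSum oddHarm2 p (r + x) -
      ((2 * x + 1) * chooseProdSum oddHarm2 p x - 2 * shiftSum x r) ∈ padicBall p 2 := by
  induction r with
  | zero => simp [shiftSum, zero_mem]
  | succ r ih =>
    have h := sum_chooseProd_step_mem hx hr
    have h1 : shiftSum x (r + 1) = shiftSum x r + 1 / ((r : ℚ) + 1 + x) ^ 2 :=
      Finset.sum_range_succ _ _
    have h2 : ∑ k ∈ Finset.range p, (chooseProd (r + 1 + x) k + chooseProd (r + x) k) * harm2 k =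
        (2 * (r + 1 + x) + 1) * chooseProdSum oddHarm2 p (r + 1 + x) -
          (2 * (r + x) + 1) * chooseProdSum oddHarm2 p (r + x) := by
      rw [chooseProdSum, chooseProdSum, Finset.mul_sum, Finset.mul_sum, ← Finset.sum_sub_distrib]
      refine Finset.sum_congr rfl fun k _ => ?_
      have := chooseProd_weighted_sub (r + 1 + x) k
      rw [show (r : ℚ) + 1 + x - 1 = r + x by ring] at this
      rw [← this, oddHarm2]
      ring
    rw [h2] at h
    convert add_mem h (ih (by omega)) using 1
    rw [h1]
    push_cast
    ring

lemma sineProd_sub_one_mem {x : ℚ} (hx : x ∈ padicBall p 1) {k : ℕ} (hk : k < p) :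
    sineProd x k - 1 ∈ padicBall p 1 := by
  induction k with
  | zero => simp [sineProd, zero_mem]
  | succ k ih =>
    have h1 := padicNorm_succ_eq_one hk
    have h0 := padicNorm_ne_zero_of_eq_one h1
    have h2 := ih (by omega)
    have h3 : sineProd x k ∈ padicBall p 0 := by
      simpa using add_mem (padicBall_mono (f := 0) (by omega) h2) one_mem_padicBall
    have : sineProd x (k + 1) - 1 =
        sineProd x k - 1 - (sineProd x k * x) * x / ((k : ℚ) + 1) ^ 2 := by
      rw [sineProd_succ]
      field_simp
      ring
    rw [this]
    refine sub_mem h2 (div_mem_padicBall (integral_mul_mem (integral_mul_mem h3 ?_) hx)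
      (padicNorm_pow_eq_one h1 2))
    exact padicBall_mono (by omega) hx

lemma chooseProd_add_mem {x : ℚ} (hx : x ∈ padicBall p 1) {k : ℕ} (hk : k + 1 < p) :
    chooseProd x (k + 1) + x / ((k : ℚ) + 1) ∈ padicBall p 2 := by
  have h1 := padicNorm_succ_eq_one hk
  have h0 := padicNorm_ne_zero_of_eq_one h1
  have h2 := sineProd_sub_one_mem (k := k) hx (by omega)
  have h3 : sineProd x k ∈ padicBall p 0 := by
    simpa using add_mem (padicBall_mono (f := 0) (by omega) h2) one_mem_padicBall
  have : chooseProd x (k + 1) + x / ((k : ℚ) + 1) =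
      -((sineProd x k - 1) * x / ((k : ℚ) + 1)) -
        sineProd x k * (x * x) / ((k : ℚ) + 1) ^ 2 := by
    rw [chooseProd_succ]
    field_simp
    ring
  rw [this]
  exact sub_mem (neg_mem (div_mem_padicBall (mul_mem_padicBall (e := 1) (f := 1) h2 hx) h1))
    (div_mem_padicBall (integral_mul_mem h3 (mul_mem_padicBall (e := 1) (f := 1) hx hx))
      (padicNorm_pow_eq_one h1 2))

/-- Modulo `p ^ 2`, the weighted sum is linear in its argument near `0`. -/
lemma chooseProdSum_linear {w : ℕ → ℚ} (hw0 : w 0 = 0) (hw : ∀ k < p, w k ∈ padicBall p 0)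
    {t : ℚ} (ht : t ∈ padicBall p 0) :
    chooseProdSum w p (t * p) + t * chooseProdSum w p (p - 1) ∈ padicBall p 2 := by
  have hp1 := prime_mem_padicBall (p := p)
  rw [show (p : ℚ) - 1 = -1 - -p by ring, chooseProdSum_neg_one_sub, chooseProdSum, chooseProdSum,
    Finset.mul_sum, ← Finset.sum_add_distrib]
  refine sum_mem fun k hk => ?_
  rw [Finset.mem_range] at hk
  cases k with
  | zero => simp [hw0, zero_mem]
  | succ k =>
    have h1 := chooseProd_add_mem (integral_mul_mem ht hp1) hk
    have h2 := chooseProd_add_mem (neg_mem hp1) hk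
    convert integral_mul_mem (hw _ hk) (add_mem h1 (integral_mul_mem ht h2)) using 1
    ring

lemma chooseProdSum_harm2_prime_sub_one (hp3 : 3 < p) :
    chooseProdSum harm2 p (p - 1) + 3 / 2 * harm2 (p - 1) ∈ padicBall p 2 := by
  have h := chooseProdSum_harm2_shift (p := p) (zero_mem _) (r := p - 1) (by omega)
  have hev : Even (p - 1) := hp.out.even_sub_one (by omega)
  rw [altShiftSum_eq, chooseProdSum_zero harm2_zero, hev.neg_one_pow, zero_div, shiftSum_zero,
    shiftSum_zero, add_zero, Nat.cast_sub (by omega), Nat.cast_one] at h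
  refine mem_of_unit_mul_mem (padicNorm_two_eq_one hp3) ?_
  convert add_mem (ofNat_mul_mem 2 h) (harm2_half hp3).1 using 1
  ring

lemma chooseProdSum_oddHarm2_prime_sub_one (hp3 : 3 < p) :
    chooseProdSum oddHarm2 p (p - 1) - 2 * harm2 (p - 1) ∈ padicBall p 2 := by
  have h := chooseProdSum_oddHarm2_shift (p := p) (zero_mem _) (r := p - 1) (by omega)
  rw [chooseProdSum_zero oddHarm2_zero, shiftSum_zero, add_zero, Nat.cast_sub (by omega),
    Nat.cast_one] at h
  have hh := mul_mem_padicBall (e := 1) (f := 1) (prime_mem_padicBall (p := p))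
    (harm2_half hp3).2.1
  have hu : padicNorm p (-1 + 2 * (p : ℚ)) = 1 :=
    padicNorm_add_eq_one (by rw [padicNorm.neg]; simp) (ofNat_mul_mem 2 prime_mem_padicBall)
  refine mem_of_unit_mul_mem hu ?_
  convert sub_mem h (ofNat_mul_mem 4 hh) using 1
  ring

lemma chooseProdSum_harm2_congr (hp3 : 3 < p) {t : ℚ} (ht : t ∈ padicBall p 0) {r : ℕ}
    (hr : r < p) :
    chooseProdSum harm2 p (r + t * p) - (-1) ^ r * (3 / 2 * t * harm2 (p - 1) -
      shiftSum (t * p / 2) (r / 2) + 2 * shiftSum (t * p) r) ∈ padicBall p 2 := by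
  have h := chooseProdSum_harm2_shift (integral_mul_mem ht prime_mem_padicBall) hr
  rw [altShiftSum_eq] at h
  have h1 := chooseProdSum_linear harm2_zero (fun k hk => harm2_mem hk) ht
  have h2 := integral_mul_mem ht (chooseProdSum_harm2_prime_sub_one hp3)
  have h3 : ((-1 : ℚ) ^ r) ∈ padicBall p 0 := pow_mem_padicBall (neg_mem one_mem_padicBall) r
  convert add_mem h (integral_mul_mem h3 (sub_mem h1 h2)) using 1
  ring

lemma chooseProdSum_oddHarm2_congr (hp3 : 3 < p) {t : ℚ} (ht : t ∈ padicBall p 0) {r : ℕ}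
    (hr : r < p) :
    (2 * (r + t * p) + 1) * chooseProdSum oddHarm2 p (r + t * p) +
      2 * (t * harm2 (p - 1) + shiftSum (t * p) r) ∈ padicBall p 2 := by
  have h := chooseProdSum_oddHarm2_shift (integral_mul_mem ht prime_mem_padicBall) hr
  have h1 := chooseProdSum_linear oddHarm2_zero (fun k hk => oddHarm2_mem hp3 hk) ht
  have h2 := integral_mul_mem ht (chooseProdSum_oddHarm2_prime_sub_one hp3)
  have h3 := sub_mem h1 h2
  have htp : 2 * (t * p) + 1 ∈ padicBall p 0 :=
    add_mem (ofNat_mul_mem 2 (integral_mul_mem ht (natCast_mem_padicBall p))) one_mem_padicBall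
  have hh := mul_mem_padicBall (e := 1) (f := 1) (prime_mem_padicBall (p := p))
    (harm2_half hp3).2.1
  convert sub_mem (add_mem h (integral_mul_mem htp h3))
    (ofNat_mul_mem 4 (integral_mul_mem (integral_mul_mem ht ht) hh)) using 1
  ring

end supercongruences

section bernoulli

lemma bpoly_eq_sum (n : ℕ) (x : ℚ) :
    bpoly n x = ∑ i ∈ Finset.range (n + 1), bernoulli (n - i) * n.choose i * x ^ i := by
  simp [bpoly, Polynomial.bernoulli_def, Polynomial.eval_finsetSum]

lemma bpoly_one_add (n : ℕ) (x : ℚ) : bpoly n (1 + x) = bpoly n x + n * x ^ (n - 1) :=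
  Polynomial.bernoulli_eval_one_add n x

lemma bpoly_one_sub {n : ℕ} (hn : Odd n) (x : ℚ) : bpoly n (1 - x) = -bpoly n x := by
  rw [bpoly, Polynomial.bernoulli_eval_one_sub, hn.neg_one_pow, bpoly]; ring

lemma sum_shift_pow_eq (m r : ℕ) (x : ℚ) :
    ∑ i ∈ Finset.range r, ((i : ℚ) + 1 + x) ^ m =
      (bpoly (m + 1) (r + 1 + x) - bpoly (m + 1) (1 + x)) / (m + 1 : ℕ) := by
  have hm : ((m + 1 : ℕ) : ℚ) ≠ 0 := by positivity
  induction r with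
  | zero => simp
  | succ r ih =>
    rw [Finset.sum_range_succ, ih]
    have h := bpoly_one_add (m + 1) (r + 1 + x)
    rw [show ((r + 1 : ℕ) : ℚ) + 1 + x = 1 + (r + 1 + x) by push_cast; ring, h,
      Nat.add_sub_cancel]
    field_simp
    ring

/-- The duplication formula for Bernoulli polynomials of odd degree. -/
lemma bpoly_two_mul {m : ℕ} (hm : Even m) (x : ℚ) :
    2 ^ m * (bpoly (m + 1) x + bpoly (m + 1) (x + 1 / 2)) = bpoly (m + 1) (2 * x) := by
  set B := Polynomial.bernoulli (m + 1) with hB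
  let D : Polynomial ℚ := Polynomial.C (2 ^ m) *
    (B + B.comp (Polynomial.X + Polynomial.C (1 / 2))) -
      B.comp (Polynomial.C 2 * Polynomial.X)
  have hD (y : ℚ) : D.eval y =
      2 ^ m * (bpoly (m + 1) y + bpoly (m + 1) (y + 1 / 2)) - bpoly (m + 1) (2 * y) := by
    simp [D, bpoly, ← hB]
  have hstep (y : ℚ) : D.eval (y + 1 / 2) = D.eval y := by
    have h1 := bpoly_one_add (m + 1) y
    have h2 := bpoly_one_add (m + 1) (2 * y)
    rw [Nat.add_sub_cancel, mul_pow] at h2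
    rw [Nat.add_sub_cancel] at h1
    rw [hD, hD, show y + 1 / 2 + 1 / 2 = 1 + y by ring,
      show 2 * (y + 1 / 2) = 1 + 2 * y by ring, h1, h2]
    ring
  have hper (n : ℕ) : D.eval ((n : ℚ) / 2) = D.eval 0 := by
    induction n with
    | zero => simp
    | succ n ih =>
      rw [show ((n + 1 : ℕ) : ℚ) / 2 = n / 2 + 1 / 2 by push_cast; ring, hstep, ih]
  have hconst : D = Polynomial.C (D.eval 0) := by
    refine Polynomial.eq_of_infinite_eval_eq _ _ (Set.Infinite.mono ?_
      (Set.infinite_range_of_injective (f := fun n : ℕ => (n : ℚ) / 2) ?_))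
    · rintro _ ⟨n, rfl⟩
      simpa using hper n
    · intro a b hab
      have : (a : ℚ) = b := by simpa using hab
      exact_mod_cast this
  have hquarter : D.eval (1 / 4) = 0 := by
    have h1 := bpoly_one_sub hm.add_one (1 / 4)
    have h2 := bpoly_one_sub hm.add_one (1 / 2)
    norm_num at h1 h2
    rw [hD]
    norm_num [h1]
    linarith
  have h := hD x
  rw [hconst, Polynomial.eval_C] at hquarter h
  linarith

end bernoulli

section padic_bernoulli

variable {p : ℕ} [hp : Fact p.Prime]

lemma prime_mul_bernoulli_mem (hp3 : 3 < p) (n : ℕ) : (p : ℚ) * bernoulli n ∈ padicBall p 0 := by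
  have hp0 := natCast_mem_padicBall (p := p) p
  rcases Nat.even_or_odd' n with ⟨k, rfl | rfl⟩
  · obtain ⟨z, hz⟩ := Bernoulli.vonStaudt_clausen k
    rw [eq_comm, ← eq_sub_iff_add_eq] at hz
    rw [hz, mul_sub, Finset.mul_sum]
    refine sub_mem (integral_mul_mem hp0 (intCast_mem_padicBall z)) (sum_mem fun q hq => ?_)
    obtain ⟨-, hq, -⟩ := Finset.mem_filter.1 hq
    by_cases h : q = p
    · subst h
      rw [mul_one_div_cancel (by exact_mod_cast hq.ne_zero)]
      exact one_mem_padicBall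
    · refine integral_mul_mem hp0 (div_mem_padicBall one_mem_padicBall ?_)
      rw [padicNorm.nat_eq_one_iff, Nat.prime_dvd_prime_iff_eq hp.out hq]
      exact fun h' => h h'.symm
  · rcases Nat.eq_zero_or_pos k with rfl | hk
    · rw [mul_zero, zero_add, bernoulli_one]
      exact integral_mul_mem hp0
        (div_mem_padicBall (neg_mem one_mem_padicBall) (padicNorm_two_eq_one hp3))
    · rw [bernoulli_eq_zero_of_odd ⟨k, rfl⟩ (by omega), mul_zero]
      exact zero_mem _

lemma pow_mem_padicBall_of_mem {x : ℚ} (hx : x ∈ padicBall p 1) (n : ℕ) :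
    x ^ n ∈ padicBall p n := by
  induction n with
  | zero => simpa using one_mem_padicBall
  | succ n ih => rw [pow_succ]; exact mul_mem_padicBall ih hx

lemma bpoly_mul_prime_congr (hp3 : 3 < p) {e m : ℕ} (hm : Even m) (hm2 : 2 ≤ m)
    (he : e = 1 ∨ e = 2 ∧ 4 ≤ m) {y : ℚ} (hy : y ∈ padicBall p 0) :
    bpoly (m + 1) (y * p) - (m + 1 : ℕ) * (y * (p * bernoulli m)) ∈ padicBall p e := by
  have hpy : y * p ∈ padicBall p 1 := integral_mul_mem hy prime_mem_padicBall
  have hterm (i n : ℕ) : bernoulli n * (m + 1).choose (i + 2) * (y * p) ^ (i + 2) ∈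
      padicBall p (i + 1) := by
    have h := mul_mem_padicBall (e := i + 1) (f := 0) (pow_mem_padicBall_of_mem hpy (i + 1))
      (prime_mul_bernoulli_mem hp3 n)
    convert integral_mul_mem (integral_mul_mem (natCast_mem_padicBall ((m + 1).choose (i + 2)))
      hy) h using 1
    ring
  rw [bpoly_eq_sum, Finset.sum_range_succ', Finset.sum_range_succ']
  have h0 : bernoulli (m + 1 - 0) = 0 := bernoulli_eq_zero_of_odd hm.add_one (by omega)
  rw [h0]
  have : ∀ S : ℚ, S + bernoulli (m + 1 - (0 + 1)) * (m + 1).choose (0 + 1) * (y * p) ^ (0 + 1) +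
      0 * (m + 1).choose 0 * (y * p) ^ 0 - (m + 1 : ℕ) * (y * (p * bernoulli m)) = S := by
    intro S
    simp
    ring
  rw [this]
  refine sum_mem fun i _ => ?_
  rcases he with rfl | ⟨rfl, hm4⟩
  · exact padicBall_mono (by omega) (hterm i _)
  · cases i with
    | zero =>
      rw [bernoulli_eq_zero_of_odd (n := m + 1 - (0 + 1 + 1)) ?_ (by omega)]
      · simp [zero_mem]
      · obtain ⟨k, rfl⟩ := hm
        exact ⟨k - 1, by omega⟩
    | succ i => exact padicBall_mono (by omega) (hterm (i + 1) _)

variable {e m : ℕ}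

lemma pow_sub_inv_sq_mem (hm : m + 2 = Nat.totient (p ^ e)) {x : ℚ} (hx : padicNorm p x = 1) :
    x ^ m - 1 / x ^ 2 ∈ padicBall p e := by
  have hx0 := padicNorm_ne_zero_of_eq_one hx
  have h := pow_totient_sub_one_mem hx e
  rw [← hm, pow_add] at h
  convert div_mem_padicBall h (padicNorm_pow_eq_one hx 2) using 1
  field_simp

lemma shiftSum_sub_bpoly_mem (hm : m + 2 = Nat.totient (p ^ e)) {x : ℚ}
    (hx : x ∈ padicBall p 1) {r : ℕ} (hr : r < p) :
    shiftSum x r - (bpoly (m + 1) (r + 1 + x) - bpoly (m + 1) (1 + x)) / (m + 1 : ℕ) ∈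
      padicBall p e := by
  rw [← sum_shift_pow_eq, shiftSum, ← Finset.sum_sub_distrib]
  refine sum_mem fun i hi => ?_
  rw [Finset.mem_range] at hi
  rw [← neg_mem_iff, neg_sub]
  exact pow_sub_inv_sq_mem hm (padicNorm_shift_eq_one hx (by omega))

lemma shiftSum_bpoly_congr (hp3 : 3 < p) (hm : m + 2 = Nat.totient (p ^ e)) (hev : Even m)
    (hm2 : 2 ≤ m) (he : e = 1 ∨ e = 2 ∧ 4 ≤ m) (hN : padicNorm p (m + 1 : ℕ) = 1)
    {y : ℚ} (hy : y ∈ padicBall p 0) {r : ℕ} (hr : r < p) :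
    shiftSum (-y * p) r - (bpoly (m + 1) (r + 1 - y * p) / (m + 1 : ℕ) + y * harm2 (p - 1)) ∈
      padicBall p e := by
  have hN0 := padicNorm_ne_zero_of_eq_one hN
  have h1 := shiftSum_sub_bpoly_mem hm (zero_mem _) (r := p - 1) (by omega)
  have h2 := div_mem_padicBall (bpoly_mul_prime_congr hp3 hev hm2 he one_mem_padicBall) hN
  have hz : bpoly (m + 1) 1 = 0 := by
    rw [bpoly, Polynomial.bernoulli_eval_one, bernoulli'_eq_zero_of_odd hev.add_one (by omega)]
  rw [shiftSum_zero, add_zero, add_zero, Nat.cast_sub (by omega), Nat.cast_one, hz,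
    sub_add_cancel] at h1
  rw [one_mul, one_mul] at h2
  have h3 := shiftSum_sub_bpoly_mem hm
    (integral_mul_mem (neg_mem hy) (prime_mem_padicBall (p := p))) hr
  have h4 := div_mem_padicBall (bpoly_mul_prime_congr hp3 hev hm2 he hy) hN
  rw [show 1 + -y * (p : ℚ) = 1 - y * p by ring, bpoly_one_sub hev.add_one] at h3
  convert add_mem h3 (sub_mem h4 (integral_mul_mem hy (add_mem h1 h2))) using 1
  rw [show (r : ℚ) + 1 - y * p = r + 1 + -y * p by ring]
  field_simp
  ring

end padic_bernoulli

section third_and_sixth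

lemma bpoly_two_thirds {n : ℕ} (hn : Odd n) : bpoly n (2 / 3) = -bpoly n (1 / 3) := by
  rw [← bpoly_one_sub hn]; norm_num

lemma bpoly_five_sixths {n : ℕ} (hn : Odd n) : bpoly n (5 / 6) = -bpoly n (1 / 6) := by
  rw [← bpoly_one_sub hn]; norm_num

lemma two_pow_mul_bpoly_one_sixth {m : ℕ} (hm : Even m) :
    2 ^ m * bpoly (m + 1) (1 / 6) = (2 ^ m + 1) * bpoly (m + 1) (1 / 3) := by
  have h := bpoly_two_mul hm (1 / 6)
  rw [show (1 : ℚ) / 6 + 1 / 2 = 2 / 3 by norm_num, show 2 * ((1 : ℚ) / 6) = 1 / 3 by norm_num,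
    bpoly_two_thirds hm.add_one] at h
  linarith

/-- The residue of `p` modulo `6`, recorded by a sign. -/
lemma Nat.Prime.exists_sign_mod_six {p : ℕ} (hp : p.Prime) (hp3 : 3 < p) :
    ∃ χ : ℚ, (χ = 1 ∨ χ = -1) ∧ (-1) ^ (p / 3) = χ ∧
      ((p / 3 : ℕ) : ℚ) = (2 * p - 3 + χ) / 6 ∧ ((p / 6 : ℕ) : ℚ) = (p - 3 + 2 * χ) / 6 := by
  have h2 : ¬ 2 ∣ p := fun h => by
    have := (Nat.prime_dvd_prime_iff_eq Nat.prime_two hp).1 h; omega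
  have h3 : ¬ 3 ∣ p := fun h => by
    have := (Nat.prime_dvd_prime_iff_eq Nat.prime_three hp).1 h; omega
  obtain ⟨k, rfl | rfl⟩ : ∃ k, p = 6 * k + 1 ∨ p = 6 * k + 5 := ⟨p / 6, by omega⟩
  · rw [show (6 * k + 1) / 3 = 2 * k by omega, show (6 * k + 1) / 6 = k by omega]
    exact ⟨1, .inl rfl, by simp, by push_cast; ring, by push_cast; ring⟩
  · rw [show (6 * k + 5) / 3 = 2 * k + 1 by omega, show (6 * k + 5) / 6 = k by omega]
    exact ⟨-1, .inr rfl, by simp [pow_succ], by push_cast; ring, by push_cast; ring⟩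

variable {p : ℕ} [hp : Fact p.Prime] {e m : ℕ}

lemma bpoly_one_sixth_sub_mem (hp3 : 3 < p) (hm : m + 2 = Nat.totient (p ^ e)) (hev : Even m)
    (hb : bpoly (m + 1) (1 / 3) ∈ padicBall p 0) :
    bpoly (m + 1) (1 / 6) - 5 * bpoly (m + 1) (1 / 3) ∈ padicBall p e := by
  have h2 := padicNorm_two_eq_one hp3
  refine mem_of_unit_mul_mem (padicNorm_pow_eq_one h2 m) ?_
  have h := pow_totient_sub_one_mem h2 e
  rw [← hm] at h
  convert integral_mul_mem (neg_mem hb) h using 1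
  rw [mul_sub, two_pow_mul_bpoly_one_sixth hev]
  ring

lemma sign_mul_mem {χ : ℚ} (hχ : χ = 1 ∨ χ = -1) {x : ℚ} (hx : x ∈ padicBall p e) :
    χ * x ∈ padicBall p e := by
  rcases hχ with rfl | rfl
  · simpa using hx
  · simpa using hx

/-- The three sums are, up to unit factors, congruent to the same Bernoulli polynomial value. -/
lemma chooseProdSum_bpoly_congr (hp3 : 3 < p) (hm : m + 2 = Nat.totient (p ^ e)) (hev : Even m)
    (hm2 : 2 ≤ m) (he : e = 1 ∨ e = 2 ∧ 4 ≤ m) (hN : padicNorm p (m + 1 : ℕ) = 1) :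
    bpoly (m + 1) (1 / 3) / (m + 1 : ℕ) ∈ padicBall p 0 ∧
    chooseProdSum harm2 p (-1 / 3) - 3 * (bpoly (m + 1) (1 / 3) / (m + 1 : ℕ)) ∈
      padicBall p e ∧
    1 / 2 * chooseProdSum oddHarm2 p (-1 / 3) - 3 * (bpoly (m + 1) (1 / 3) / (m + 1 : ℕ)) ∈
      padicBall p e ∧
    chooseProdSum oddHarm2 p (-1 / 6) - 15 * (bpoly (m + 1) (1 / 3) / (m + 1 : ℕ)) ∈
      padicBall p e := by
  obtain ⟨χ, hχ, hsign, hr3, hr6⟩ := hp.out.exists_sign_mod_six hp3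
  have he2 : e ≤ 2 := by omega
  have h2 := padicNorm_two_eq_one hp3
  have h3 := padicNorm_three_eq_one hp3
  have hN0 := padicNorm_ne_zero_of_eq_one hN
  have hχ2 : χ * χ = 1 := by rcases hχ with rfl | rfl <;> norm_num
  have hthird : (1 / 3 : ℚ) ∈ padicBall p 0 := div_mem_padicBall one_mem_padicBall h3
  have hsixth : (1 / 6 : ℚ) ∈ padicBall p 0 := by
    rw [show (1 / 6 : ℚ) = 1 / 3 / 2 by norm_num]
    exact div_mem_padicBall hthird h2
  have hlt3 : p / 3 < p := by omega
  have hlt6 : p / 6 < p := by omega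
  set b := bpoly (m + 1) (1 / 3) with hb
  have hodd := hev.add_one
  have hT3 := shiftSum_bpoly_congr hp3 hm hev hm2 he hN hthird hlt3
  have hT6 := shiftSum_bpoly_congr hp3 hm hev hm2 he hN hsixth hlt6
  have e3 : bpoly (m + 1) ((p / 3 : ℕ) + 1 - 1 / 3 * p) = -χ * b := by
    rw [hr3]
    rcases hχ with rfl | rfl
    · rw [show (2 * (p : ℚ) - 3 + 1) / 6 + 1 - 1 / 3 * p = 2 / 3 by ring,
        bpoly_two_thirds hodd]
      ring
    · rw [show (2 * (p : ℚ) - 3 + -1) / 6 + 1 - 1 / 3 * p = 1 / 3 by ring]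
      ring
  have e6 : bpoly (m + 1) ((p / 6 : ℕ) + 1 - 1 / 6 * p) = -χ * bpoly (m + 1) (1 / 6) := by
    rw [hr6]
    rcases hχ with rfl | rfl
    · rw [show ((p : ℚ) - 3 + 2 * 1) / 6 + 1 - 1 / 6 * p = 5 / 6 by ring,
        bpoly_five_sixths hodd]
      ring
    · rw [show ((p : ℚ) - 3 + 2 * -1) / 6 + 1 - 1 / 6 * p = 1 / 6 by ring]
      ring
  rw [e3] at hT3
  rw [e6] at hT6
  have hp1 := prime_mem_padicBall (p := p)
  have hβ : b / (m + 1 : ℕ) ∈ padicBall p 0 := by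
    have hs := shiftSum_mem (integral_mul_mem (neg_mem hthird) hp1) hlt3
    have hh := integral_mul_mem hthird (padicBall_mono (f := 0) (by omega) (harm2_half hp3).2.1)
    convert sign_mul_mem hχ (sub_mem (sub_mem (padicBall_mono (f := 0) (by omega) hT3) hs)
      (neg_mem hh)) using 1
    linear_combination (-(b / (m + 1 : ℕ))) * hχ2
  have hbm : b ∈ padicBall p 0 := by
    convert integral_mul_mem hβ (natCast_mem_padicBall (m + 1)) using 1
    field_simp
  have hT6' := sub_mem hT6 (sign_mul_mem hχ
    (div_mem_padicBall (bpoly_one_sixth_sub_mem hp3 hm hev hbm) hN))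
  have a3 : ((p / 3 : ℕ) : ℚ) + -(1 / 3) * p = -1 / 2 + χ / 6 := by rw [hr3]; ring
  have a6 : ((p / 6 : ℕ) : ℚ) + -(1 / 6) * p = -1 / 2 + χ / 3 := by rw [hr6]; ring
  have s3 (w : ℕ → ℚ) : chooseProdSum w p (-1 / 2 + χ / 6) = chooseProdSum w p (-1 / 3) := by
    rcases hχ with rfl | rfl
    · norm_num
    · rw [← chooseProdSum_neg_one_sub]; norm_num
  have s6 (w : ℕ → ℚ) : chooseProdSum w p (-1 / 2 + χ / 3) = chooseProdSum w p (-1 / 6) := by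
    rcases hχ with rfl | rfl
    · norm_num
    · rw [← chooseProdSum_neg_one_sub]; norm_num
  have h1 := padicBall_mono he2 (chooseProdSum_harm2_congr hp3 (neg_mem hthird) hlt3)
  have h1' := padicBall_mono he2 (chooseProdSum_oddHarm2_congr hp3 (neg_mem hthird) hlt3)
  have h1'' := padicBall_mono he2 (chooseProdSum_oddHarm2_congr hp3 (neg_mem hsixth) hlt6)
  rw [a3, s3, hsign, Nat.div_div_eq_div_mul,
    show -(1 / 3) * (p : ℚ) / 2 = -(1 / 6) * p by ring] at h1
  rw [a3, s3] at h1'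
  rw [a6, s6] at h1''
  set T3 := shiftSum (-(1 / 3) * (p : ℚ)) (p / 3)
  set T6 := shiftSum (-(1 / 6) * (p : ℚ)) (p / 6)
  set h := harm2 (p - 1)
  refine ⟨hβ, ?_, ?_, ?_⟩
  · convert add_mem h1 (sign_mul_mem hχ (sub_mem (ofNat_mul_mem 2 hT3) hT6')) using 1
    linear_combination 3 * (b / (m + 1 : ℕ)) * hχ2
  · refine mem_of_unit_mul_mem h2 ?_
    convert sign_mul_mem hχ (ofNat_mul_mem 3 (sub_mem h1' (ofNat_mul_mem 2 hT3))) using 1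
    linear_combination (6 * (b / (m + 1 : ℕ)) - chooseProdSum oddHarm2 p (-1 / 3)) * hχ2
  · refine mem_of_unit_mul_mem h2 ?_
    convert sign_mul_mem hχ (ofNat_mul_mem 3 (sub_mem h1'' (ofNat_mul_mem 2 hT6'))) using 1
    linear_combination (30 * (b / (m + 1 : ℕ)) - 2 * chooseProdSum oddHarm2 p (-1 / 6)) * hχ2

end third_and_sixth

lemma chooseProdSum_congr_five [Fact (Nat.Prime 5)] :
    1 / 2 * chooseProdSum oddHarm2 5 (-1 / 3) - 1 / 5 * chooseProdSum oddHarm2 5 (-1 / 6) ∈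
      padicBall 5 2 := by
  have h : 1 / 2 * chooseProdSum oddHarm2 5 (-1 / 3) -
      1 / 5 * chooseProdSum oddHarm2 5 (-1 / 6) = 831964133 / 417942208512 * (5 * 5) := by
    simp [chooseProdSum, chooseProd, oddHarm2, harm2, Finset.sum_range_succ,
      Finset.prod_range_succ]
    norm_num
  have h5 := prime_mem_padicBall (p := 5)
  rw [h]
  exact integral_mul_mem (div_mem_padicBall (mod_cast natCast_mem_padicBall 831964133)
    ((padicNorm.nat_eq_one_iff 417942208512).2 (by norm_num)))
    (mul_mem_padicBall (e := 1) (f := 1) h5 h5)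

section sixth_congruence

variable {p : ℕ} [hp : Fact p.Prime] {e m : ℕ}

lemma chooseProdSum_sixth_congr (hp3 : 3 < p) (hm : m + 2 = Nat.totient (p ^ e)) (hev : Even m)
    (hm2 : 2 ≤ m) (he : e = 1 ∨ e = 2 ∧ 4 ≤ m) (hN : padicNorm p (m + 1 : ℕ) = 1) :
    1 / 5 * chooseProdSum oddHarm2 p (-1 / 6) - 3 * (bpoly (m + 1) (1 / 3) / (m + 1 : ℕ)) ∈
      padicBall p e := by
  obtain ⟨-, -, h2, h3⟩ := chooseProdSum_bpoly_congr hp3 hm hev hm2 he hN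
  rcases eq_or_ne p 5 with rfl | h5
  · convert sub_mem h2 (padicBall_mono (f := e) (by omega) chooseProdSum_congr_five) using 1
    ring
  · have h5' : padicNorm p 5 = 1 := by
      refine mod_cast (padicNorm.nat_eq_one_iff (p := p) 5).2 ?_
      rwa [Nat.prime_dvd_prime_iff_eq hp.out Nat.prime_five]
    refine mem_of_unit_mul_mem h5' ?_
    convert h3 using 1
    ring

end sixth_congruence

lemma sum_choose_27 (n : ℕ) :
    ∑ k ∈ Finset.range n, (Nat.choose (2 * k) k : ℚ) * (Nat.choose (3 * k) k) / 27 ^ k *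
      harm2 k = chooseProdSum harm2 n (-1 / 3) := by
  simp only [choose_mul_choose_div_pow_27, chooseProdSum]

lemma sum_choose_27_odd (n : ℕ) :
    ∑ k ∈ Finset.range n, (Nat.choose (2 * k) k : ℚ) * (Nat.choose (3 * k) k) /
      ((2 * k + 1) * 27 ^ k) * harm2 k = chooseProdSum oddHarm2 n (-1 / 3) := by
  refine Finset.sum_congr rfl fun k _ => ?_
  rw [← choose_mul_choose_div_pow_27, oddHarm2, mul_comm (2 * (k : ℚ) + 1), ← div_div,
    div_mul_eq_mul_div, mul_div_assoc]

lemma sum_choose_432_odd (n : ℕ) :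
    ∑ k ∈ Finset.range n, (Nat.choose (6 * k) (3 * k) : ℚ) * (Nat.choose (3 * k) k) /
      ((2 * k + 1) * 432 ^ k) * harm2 k = chooseProdSum oddHarm2 n (-1 / 6) := by
  refine Finset.sum_congr rfl fun k _ => ?_
  rw [← choose_mul_choose_div_pow_432, oddHarm2, mul_comm (2 * (k : ℚ) + 1), ← div_div,
    div_mul_eq_mul_div, mul_div_assoc]

theorem stmt_15 (p : ℕ) (hp : p.Prime) (hp3 : 3 < p) :
    CongrMod p 2
      (∑ k ∈ Finset.range p,
        (Nat.choose (2 * k) k : ℚ) * (Nat.choose (3 * k) k) / 27 ^ k * harm2 k)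
      (1 / 2 * ∑ k ∈ Finset.range p,
        (Nat.choose (2 * k) k : ℚ) * (Nat.choose (3 * k) k) /
          ((2 * k + 1) * 27 ^ k) * harm2 k) ∧
    CongrMod p 2
      (1 / 2 * ∑ k ∈ Finset.range p,
        (Nat.choose (2 * k) k : ℚ) * (Nat.choose (3 * k) k) /
          ((2 * k + 1) * 27 ^ k) * harm2 k)
      (1 / 5 * ∑ k ∈ Finset.range p,
        (Nat.choose (6 * k) (3 * k) : ℚ) * (Nat.choose (3 * k) k) /
          ((2 * k + 1) * 432 ^ k) * harm2 k) ∧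
    CongrMod p 2
      (1 / 5 * ∑ k ∈ Finset.range p,
        (Nat.choose (6 * k) (3 * k) : ℚ) * (Nat.choose (3 * k) k) /
          ((2 * k + 1) * 432 ^ k) * harm2 k)
      ((3 * p - 3) * bpoly (p ^ 2 - p - 1) (1 / 3)) ∧
    CongrMod p 1
      (∑ k ∈ Finset.range p,
        (Nat.choose (2 * k) k : ℚ) * (Nat.choose (3 * k) k) / 27 ^ k * harm2 k)
      (-(3 / 2) * bpoly (p - 2) (1 / 3)) ∧
    CongrMod p 1
      (1 / 2 * ∑ k ∈ Finset.range p,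
        (Nat.choose (2 * k) k : ℚ) * (Nat.choose (3 * k) k) /
          ((2 * k + 1) * 27 ^ k) * harm2 k)
      (-(3 / 2) * bpoly (p - 2) (1 / 3)) ∧
    CongrMod p 1
      (1 / 5 * ∑ k ∈ Finset.range p,
        (Nat.choose (6 * k) (3 * k) : ℚ) * (Nat.choose (3 * k) k) /
          ((2 * k + 1) * 432 ^ k) * harm2 k)
      (-(3 / 2) * bpoly (p - 2) (1 / 3)) := by
  have : Fact p.Prime := ⟨hp⟩
  simp only [sum_choose_27, sum_choose_27_odd, sum_choose_432_odd, congrMod_iff]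
  obtain ⟨q, hq⟩ : ∃ q, p = 2 * q + 1 := hp.odd_of_ne_two (by omega)
  have hp1 := prime_mem_padicBall (p := p)
  -- modulo `p ^ 2`, with `m = p (p - 1) - 2`
  obtain ⟨m, hm⟩ : ∃ m, p * (p - 1) = m + 2 := ⟨p * (p - 1) - 2, by
    have : 5 * 4 ≤ p * (p - 1) := Nat.mul_le_mul (by omega) (by omega)
    omega⟩
  have hm4 : 20 ≤ m + 2 := hm ▸ Nat.mul_le_mul (by omega : 5 ≤ p) (by omega : 4 ≤ p - 1)
  have hmQ : (m : ℚ) + 2 = p * (p - 1) := by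
    rw [← Nat.cast_pred hp.pos]
    exact_mod_cast hm.symm
  have hmN : p ^ 2 - p - 1 = m + 1 := by
    rw [Nat.mul_sub, mul_one, ← sq] at hm
    omega
  have hm' : m + 2 = Nat.totient (p ^ 2) := by
    rw [Nat.totient_prime_pow hp (by norm_num), ← hm]; simp
  have hev : Even m := by
    have h : Even (m + 2) := hm ▸ (hp.even_sub_one (by omega)).mul_left p
    simpa [Nat.even_add] using h
  have hN : padicNorm p (m + 1 : ℕ) = 1 := by
    rw [padicNorm.nat_eq_one_iff]
    intro h
    have h' : p ∣ m + 1 + 1 := ⟨p - 1, by omega⟩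
    exact hp.one_lt.ne' (Nat.dvd_one.1 ((Nat.dvd_add_right h).1 h'))
  obtain ⟨hβ, h1, h2, -⟩ := chooseProdSum_bpoly_congr hp3 hm' hev (by omega)
    (.inr ⟨rfl, by omega⟩) hN
  have h3 := chooseProdSum_sixth_congr hp3 hm' hev (by omega) (.inr ⟨rfl, by omega⟩) hN
  -- modulo `p`, with `m = p - 3`
  obtain ⟨n, hn⟩ : ∃ n, p = n + 3 := ⟨p - 3, by omega⟩
  have hnQ : (n : ℚ) + 3 = p := by exact_mod_cast hn.symm
  have hn' : n + 2 = Nat.totient (p ^ 1) := by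
    rw [pow_one, Nat.totient_prime hp]; omega
  have hevn : Even n := ⟨q - 1, by omega⟩
  have hN' : padicNorm p (n + 1 : ℕ) = 1 := padicNorm_natCast_eq_one (by omega) (by omega)
  obtain ⟨hβ', k1, k2, -⟩ := chooseProdSum_bpoly_congr hp3 hn' hevn (by omega) (.inl rfl) hN'
  have k3 := chooseProdSum_sixth_congr hp3 hn' hevn (by omega) (.inl rfl) hN'
  have hB : (3 * p - 3) * bpoly (p ^ 2 - p - 1) (1 / 3) -
      3 * (bpoly (m + 1) (1 / 3) / (m + 1 : ℕ)) ∈ padicBall p 2 := by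
    have hN0 := padicNorm_ne_zero_of_eq_one hN
    convert integral_mul_mem (integral_mul_mem (intCast_mem_padicBall (3 * (p - 2))) hβ)
      (mul_mem_padicBall (e := 1) (f := 1) hp1 hp1) using 1
    rw [hmN]
    field_simp
    push_cast
    linear_combination (3 * (p : ℚ) - 3) * bpoly (m + 1) (1 / 3) * hmQ
  have hB' : -(3 / 2) * bpoly (p - 2) (1 / 3) -
      3 * (bpoly (n + 1) (1 / 3) / (n + 1 : ℕ)) ∈ padicBall p 1 := by
    have hN0 := padicNorm_ne_zero_of_eq_one hN'
    refine mem_of_unit_mul_mem (padicNorm_two_eq_one hp3) ?_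
    convert integral_mul_mem (integral_mul_mem (intCast_mem_padicBall (-3)) hβ') hp1 using 1
    rw [show p - 2 = n + 1 by omega]
    field_simp
    push_cast
    linear_combination (-3) * bpoly (n + 1) (1 / 3) * hnQ
  refine ⟨?_, ?_, ?_, ?_, ?_, ?_⟩
  · simpa using sub_mem h1 h2
  · simpa using sub_mem h2 h3
  · simpa using sub_mem h3 hB
  · simpa using sub_mem k1 hB'
  · simpa using sub_mem k2 hB'
  · simpa using sub_mem k3 hB'
end

section
/- For any positive integer k and any rational number x, C(-x,k)·C(x-1,k) + C(x,k)·C(-x-1,k) = 2·(C(x-1,k)·C(-x-1,k) − C(x-1,k-1)·C(-x-1,k-1)). -/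
open Finset

theorem gchoose_succ (a : ℚ) (n : ℕ) :
    gchoose a (n + 1) = gchoose a n * (a - n) / (n + 1) := by
  simp only [gchoose, Finset.prod_range_succ, Nat.factorial_succ, Nat.cast_mul, Nat.cast_add,
    Nat.cast_one]
  field_simp

theorem gchoose_succ_eq_mul_gchoose_sub_one (a : ℚ) (n : ℕ) :
    gchoose a (n + 1) = a * gchoose (a - 1) n / (n + 1) := by
  have h (j : ℕ) : a - (j + 1) = a - 1 - j := by ring
  simp only [gchoose, Finset.prod_range_succ', Nat.factorial_succ, Nat.cast_mul, Nat.cast_add,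
    Nat.cast_one, Nat.cast_zero, sub_zero, h]
  field_simp

theorem stmt_16 (k : ℕ) (hk : 0 < k) (x : ℚ) :
    gchoose (-x) k * gchoose (x - 1) k + gchoose x k * gchoose (-x - 1) k =
      2 * (gchoose (x - 1) k * gchoose (-x - 1) k -
        gchoose (x - 1) (k - 1) * gchoose (-x - 1) (k - 1)) := by
  obtain ⟨n, rfl⟩ := Nat.exists_eq_add_one.mpr hk
  rw [Nat.add_sub_cancel, gchoose_succ_eq_mul_gchoose_sub_one x,
    gchoose_succ_eq_mul_gchoose_sub_one (-x), gchoose_succ (x - 1), gchoose_succ (-x - 1)]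
  field_simp
  ring
end
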